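/- arXiv:1504.08138 — 6 statements merged into one kernel-verified Lean document; each statement's English description precedes it below -/
import Mathlib

section
/- The ℚ-vector subspace of the formal power series ring ℚ[[q]] spanned by the constant series 1 together with all bi-brackets [s₁,…,sₗ; r₁,…,rₗ] (over all lengths l ≥ 1, all integers s₁,…,sₗ ≥ 1 and r₁,…,rₗ ≥ 0) is closed under multiplication of formal power series; that is, this span is a ℚ-subalgebra of ℚ[[q]]. -/
open scoped Nat

/-- The bi-bracket `[s₁,…,sₗ; r₁,…,rₗ]`: the formal power series in `ℚ[[q]]` whose
coefficient of `qⁿ` is the sum of `∏ⱼ (uⱼ^{rⱼ}/rⱼ!)·(vⱼ^{sⱼ−1}/(sⱼ−1)!)` over all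
tuples `u₁ > … > uₗ > 0`, `v₁,…,vₗ > 0` with `u₁v₁ + … + uₗvₗ = n`. -/
noncomputable def biBracket (l : ℕ) (s r : Fin l → ℕ) : PowerSeries ℚ :=
  PowerSeries.mk fun n =>
    ∑ᶠ uv ∈ {uv : (Fin l → ℕ) × (Fin l → ℕ) |
        StrictAnti uv.1 ∧ (∀ j, 0 < uv.1 j) ∧ (∀ j, 0 < uv.2 j) ∧
        (∑ j, uv.1 j * uv.2 j) = n},
      ∏ j, ((uv.1 j : ℚ) ^ r j / (r j)!) * ((uv.2 j : ℚ) ^ (s j - 1) / ((s j - 1)!))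

/-- The set consisting of the constant power series `1` together with all
bi-brackets `[s₁,…,sₗ; r₁,…,rₗ]` with `l ≥ 1`, all `sⱼ ≥ 1` (and `rⱼ ≥ 0`). -/
def biBracketSet : Set (PowerSeries ℚ) :=
  {1} ∪ {f | ∃ l : ℕ, 1 ≤ l ∧ ∃ s r : Fin l → ℕ, (∀ j, 1 ≤ s j) ∧ f = biBracket l s r}

open Finset Polynomial in
/-- Convolutions of monomials are polynomial in the upper summation bound. -/
theorem exists_polynomial_sum_pow_mul_pow (b a : ℕ) :
    ∃ Q : ℚ[X], ∀ n : ℕ, ∑ k ∈ range n, (k : ℚ) ^ a * ((n : ℚ) - k) ^ b = Q.eval (n : ℚ) := by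
  induction b generalizing a with
  | zero =>
    refine ⟨∑ i ∈ range (a + 1),
      Polynomial.C (_root_.bernoulli i * ((a + 1).choose i) / (a + 1)) * X ^ (a + 1 - i),
      fun n => ?_⟩
    simp only [pow_zero, mul_one, sum_range_pow, eval_finsetSum, eval_mul, eval_C, eval_pow, eval_X]
    exact sum_congr rfl fun i _ => by ring
  | succ b ih =>
    obtain ⟨Q, hQ⟩ := ih a
    obtain ⟨R, hR⟩ := ih (a + 1)
    refine ⟨X * Q - R, fun n => ?_⟩
    rw [eval_sub, eval_mul, eval_X, ← hQ, ← hR, mul_sum, ← sum_sub_distrib]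
    exact sum_congr rfl fun i _ => by ring

/-- The series `∑_{v ≥ 1} (v^a/a!) q^v`. -/
noncomputable def powSeries (a : ℕ) : PowerSeries ℚ :=
  PowerSeries.mk fun v => if v = 0 then 0 else (v : ℚ) ^ a / (a ! : ℚ)

open Polynomial in
theorem mk_eval_mem_span_powSeries (p : ℚ[X]) :
    (PowerSeries.mk fun v : ℕ => if v = 0 then 0 else p.eval (v : ℚ)) ∈
      Submodule.span ℚ (Set.range powSeries) := by
  induction p using Polynomial.induction_on' with
  | add p q hp hq =>
    convert add_mem hp hq using 1
    ext n
    by_cases h : n = 0 <;> simp [h]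
  | monomial a c =>
    convert Submodule.smul_mem _ (c * a !) (Submodule.subset_span (Set.mem_range_self a)) using 1
    ext n
    have : (a ! : ℚ) ≠ 0 := by positivity
    by_cases h : n = 0
    · simp [h, powSeries]
    · simp [h, powSeries]
      field_simp

open Finset Polynomial in
theorem powSeries_mul_mem (a b : ℕ) :
    powSeries a * powSeries b ∈ Submodule.span ℚ (Set.range powSeries) := by
  obtain ⟨Q, hQ⟩ := exists_polynomial_sum_pow_mul_pow b a
  convert mk_eval_mem_span_powSeries
    (Polynomial.C (1 / ((a ! : ℚ) * b !)) * (Q - Polynomial.C (0 ^ a) * X ^ b)) using 1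
  ext n
  rw [PowerSeries.coeff_mul, Nat.sum_antidiagonal_eq_sum_range_succ
    (fun i j => PowerSeries.coeff i (powSeries a) * PowerSeries.coeff j (powSeries b)),
    sum_range_succ]
  rcases n with _ | n
  · simp [powSeries]
  · simp only [powSeries, PowerSeries.coeff_mk, eval_mul, eval_sub, eval_C, eval_pow, eval_X, ← hQ]
    rw [sum_range_succ', sum_range_succ' (fun k : ℕ => (k : ℚ) ^ a * _)]
    simp only [Nat.cast_zero, sub_zero, Nat.sub_self, if_true, mul_zero, add_zero, zero_mul,
      add_sub_cancel_right, mul_sum, Nat.succ_ne_zero, if_false]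
    refine sum_congr rfl fun k hk => ?_
    have hk' := mem_range.1 hk
    rw [if_neg (by omega), Nat.cast_sub (by omega)]
    field_simp

/-- The map sending a series `f` to the function `u ↦ (u^r/r!) f(q^u)`, with value `0` at `0`. -/
noncomputable def dilate (r : ℕ) : PowerSeries ℚ →ₗ[ℚ] (ℕ → PowerSeries ℚ) :=
  LinearMap.pi fun u =>
    if h : u = 0 then 0 else ((u : ℚ) ^ r / r !) • (PowerSeries.expand u h).toLinearMap

theorem dilate_apply_of_ne {r u : ℕ} (h : u ≠ 0) (f : PowerSeries ℚ) :
    dilate r f u = ((u : ℚ) ^ r / r !) • PowerSeries.expand u h f := by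
  simp [dilate, h]

theorem dilate_apply_zero (r : ℕ) (f : PowerSeries ℚ) : dilate r f 0 = 0 := by
  simp [dilate]

theorem dilate_mul_dilate (r t : ℕ) (f g : PowerSeries ℚ) :
    dilate r f * dilate t g = (((r + t)! : ℚ) / (r ! * t !)) • dilate (r + t) (f * g) := by
  funext u
  rcases eq_or_ne u 0 with rfl | h
  · simp [dilate_apply_zero]
  · simp only [Pi.mul_apply, Pi.smul_apply, dilate_apply_of_ne h, map_mul, smul_mul_smul_comm,
      smul_smul]
    congr 1
    have : ((r + t)! : ℚ) ≠ 0 := by positivity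
    field_simp
    ring

/-- The factor `u ↦ ∑_{v ≥ 1} (u^r/r!) (v^a/a!) q^{uv}` of a bi-bracket. -/
noncomputable def biLetter (x : ℕ × ℕ) : ℕ → PowerSeries ℚ :=
  dilate x.1 (powSeries x.2)

theorem biLetter_mul_mem (x y : ℕ × ℕ) :
    biLetter x * biLetter y ∈ Submodule.span ℚ (Set.range biLetter) := by
  rw [biLetter, biLetter, dilate_mul_dilate]
  refine Submodule.smul_mem _ _ ?_
  have h := Submodule.mem_map_of_mem (f := dilate (x.1 + y.1)) (powSeries_mul_mem x.2 y.2)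
  rw [Submodule.map_span, ← Set.range_comp] at h
  refine Submodule.span_mono ?_ h
  rintro _ ⟨a, rfl⟩
  exact ⟨(x.1 + y.1, a), rfl⟩

open Finset in
/-- The sum of `∏ⱼ fⱼ(uⱼ)` over `N > u₁ > … > uₗ ≥ 0`. -/
def iteratedSum {A : Type*} [CommRing A] {l : ℕ} (f : Fin l → ℕ → A) (N : ℕ) : A :=
  ∑ u ∈ (Fintype.piFinset fun _ : Fin l => range N) with StrictAnti u, ∏ j, f j (u j)

section IteratedSum

open Finset

variable {A : Type*} [CommRing A]

theorem iteratedSum_zero (f : Fin 0 → ℕ → A) (N : ℕ) : iteratedSum f N = 1 := by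
  simp [iteratedSum, Subsingleton.strictAnti]

theorem strictAnti_fin_cons_iff {l a : ℕ} {u : Fin l → ℕ} :
    StrictAnti (Fin.cons a u : Fin (l + 1) → ℕ) ↔ (∀ j, u j < a) ∧ StrictAnti u := by
  constructor
  · intro h
    refine ⟨fun j => ?_, fun i j hij => ?_⟩
    · simpa using h (Fin.succ_pos j)
    · simpa using h (Fin.succ_lt_succ_iff.2 hij)
  · rintro ⟨h₁, h₂⟩ i j hij
    cases j using Fin.cases with
    | zero => exact absurd hij (Fin.not_lt_zero i)
    | succ j =>
      cases i using Fin.cases with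
      | zero => simpa using h₁ j
      | succ i => simpa using h₂ (Fin.succ_lt_succ_iff.1 hij)

theorem iteratedSum_cons {l : ℕ} (p : ℕ → A) (f : Fin l → ℕ → A) (N : ℕ) :
    iteratedSum (Fin.cons p f : Fin (l + 1) → ℕ → A) N =
      ∑ u ∈ range N, p u * iteratedSum f u := by
  simp only [iteratedSum, mul_sum]
  rw [sum_sigma']
  symm
  refine sum_bij' (fun x _ => Fin.cons x.1 x.2) (fun u _ => ⟨u 0, Fin.tail u⟩) ?_ ?_ ?_ ?_ ?_
  · rintro ⟨a, u⟩ h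
    simp only [mem_sigma, mem_range, mem_filter, Fintype.mem_piFinset] at h
    simp only [mem_filter, Fintype.mem_piFinset, mem_range, strictAnti_fin_cons_iff]
    refine ⟨fun j => ?_, h.2⟩
    cases j using Fin.cases with
    | zero => exact h.1
    | succ j => exact (h.2.1 j).trans h.1
  · intro u h
    rw [← Fin.cons_self_tail u] at h
    simp only [mem_filter, Fintype.mem_piFinset, mem_range, strictAnti_fin_cons_iff] at h
    simp only [mem_sigma, mem_range, mem_filter, Fintype.mem_piFinset]
    exact ⟨h.1 0, h.2⟩
  · simp
  · simp
  · simp [Fin.prod_univ_succ]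

/-- Summation by parts for a product of two sums. -/
theorem sum_range_mul_sum_range (f g : ℕ → A) (N : ℕ) :
    (∑ u ∈ range N, f u) * ∑ u ∈ range N, g u =
      ∑ u ∈ range N, (f u * ∑ i ∈ range u, g i) + ∑ u ∈ range N, (g u * ∑ i ∈ range u, f i) +
        ∑ u ∈ range N, f u * g u := by
  induction N with
  | zero => simp
  | succ N ih =>
    simp only [sum_range_succ]
    linear_combination ih

variable [Algebra ℚ A] {ι : Type*}

/-- The span of the iterated sums whose factors are taken from the family `L`. -/
def iteratedSpan (L : ι → ℕ → A) : Submodule ℚ (ℕ → A) :=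
  Submodule.span ℚ (Set.range fun w : Σ l : ℕ, Fin l → ι => iteratedSum fun j => L (w.2 j))

theorem iteratedSum_mem_iteratedSpan (L : ι → ℕ → A) {l : ℕ} (w : Fin l → ι) :
    (iteratedSum fun j => L (w j)) ∈ iteratedSpan L :=
  Submodule.subset_span ⟨⟨l, w⟩, rfl⟩

theorem sum_range_mem_iteratedSpan {L : ι → ℕ → A} {p h : ℕ → A}
    (hp : p ∈ Submodule.span ℚ (Set.range L)) (hh : h ∈ iteratedSpan L) :
    (fun N => ∑ u ∈ range N, p u * h u) ∈ iteratedSpan L := by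
  let S : (ℕ → A) →ₗ[ℚ] (ℕ → A) :=
    { toFun := fun k N => ∑ u ∈ range N, k u
      map_add' := fun k k' => by funext N; simp [sum_add_distrib]
      map_smul' := fun c k => by funext N; simp [smul_sum] }
  suffices Submodule.span ℚ (Set.range L) * iteratedSpan L ≤ (iteratedSpan L).comap S from
    this (Submodule.mul_mem_mul hp hh)
  rw [iteratedSpan, Submodule.span_mul_span, Submodule.span_le]
  rintro _ ⟨_, ⟨i, rfl⟩, _, ⟨⟨l, w⟩, rfl⟩, rfl⟩
  have := iteratedSum_mem_iteratedSpan L (Fin.cons i w : Fin (l + 1) → ι)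
  have e : (fun j => L ((Fin.cons i w : Fin (l + 1) → ι) j)) =
      (Fin.cons (L i) fun j => L (w j) : Fin (l + 1) → ℕ → A) := by
    funext j
    cases j using Fin.cases <;> simp
  rw [e] at this
  rwa [funext (iteratedSum_cons (L i) fun j => L (w j))] at this

/-- The quasi-shuffle product of iterated sums. -/
theorem iteratedSum_mul_mem {L : ι → ℕ → A}
    (hL : ∀ i j, L i * L j ∈ Submodule.span ℚ (Set.range L)) {l m : ℕ}
    (w : Fin l → ι) (z : Fin m → ι) :
    ((iteratedSum fun j => L (w j)) * iteratedSum fun j => L (z j)) ∈ iteratedSpan L := by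
  have cons_eq {n : ℕ} (x : Fin (n + 1) → ι) (N : ℕ) : (iteratedSum fun j => L (x j)) N =
      ∑ u ∈ range N, L (x 0) u * (iteratedSum fun j => L (Fin.tail x j)) u := by
    rw [← iteratedSum_cons]
    congr 1
    funext j
    cases j using Fin.cases <;> simp [Fin.tail]
  have one_eq {x : Fin 0 → ι} : (iteratedSum fun j => L (x j)) = 1 :=
    funext fun N => iteratedSum_zero _ N
  induction l generalizing m with
  | zero => rw [one_eq, one_mul]; exact iteratedSum_mem_iteratedSpan L z
  | succ l ihl =>
    induction m with
    | zero => rw [one_eq, mul_one]; exact iteratedSum_mem_iteratedSpan L w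
    | succ m ihm =>
      have h₁ := sum_range_mem_iteratedSpan (Submodule.subset_span (Set.mem_range_self (w 0)))
        (ihl (Fin.tail w) z)
      have h₂ := sum_range_mem_iteratedSpan (Submodule.subset_span (Set.mem_range_self (z 0)))
        (ihm (Fin.tail z))
      have h₃ := sum_range_mem_iteratedSpan (hL (w 0) (z 0)) (ihl (Fin.tail w) (Fin.tail z))
      convert add_mem (add_mem h₁ h₂) h₃ using 1
      funext N
      simp only [Pi.mul_apply, Pi.add_apply]
      simp only [cons_eq w, cons_eq z]
      rw [sum_range_mul_sum_range]
      congr 1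
      · congr 1 <;> exact sum_congr rfl fun u _ => by ring
      · exact sum_congr rfl fun u _ => by ring

end IteratedSum

theorem coeff_biLetter_mul (x : ℕ × ℕ) {u v : ℕ} (hu : 0 < u) (hv : 0 < v) :
    PowerSeries.coeff (u * v) (biLetter x u) =
      ((u : ℚ) ^ x.1 / x.1 !) * ((v : ℚ) ^ x.2 / x.2 !) := by
  rw [biLetter, dilate_apply_of_ne hu.ne', PowerSeries.coeff_smul, PowerSeries.coeff_expand_mul]
  simp [powSeries, hv.ne']

theorem exists_eq_mul_of_coeff_biLetter_ne_zero {x : ℕ × ℕ} {u n : ℕ}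
    (h : PowerSeries.coeff n (biLetter x u) ≠ 0) : 0 < u ∧ ∃ v, 0 < v ∧ n = u * v := by
  rcases Nat.eq_zero_or_pos u with rfl | hu
  · simp [biLetter, dilate_apply_zero] at h
  refine ⟨hu, ?_⟩
  rw [biLetter, dilate_apply_of_ne hu.ne', PowerSeries.coeff_smul] at h
  by_cases hd : u ∣ n
  · obtain ⟨v, rfl⟩ := hd
    refine ⟨v, Nat.pos_of_ne_zero ?_, rfl⟩
    rintro rfl
    rw [PowerSeries.coeff_expand_mul] at h
    simp [powSeries] at h
  · simp [PowerSeries.coeff_expand_of_not_dvd u hu.ne' _ hd] at h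

open Finset in
theorem coeff_iteratedSum_biLetter {l : ℕ} (s r : Fin l → ℕ) {n N : ℕ} (hN : n < N) :
    PowerSeries.coeff n (iteratedSum (fun j => biLetter (r j, s j - 1)) N) =
      PowerSeries.coeff n (biBracket l s r) := by
  classical
  let T : Finset ((Fin l → ℕ) × (Fin l → ℕ)) :=
    ((Fintype.piFinset fun _ => range N) ×ˢ (Fintype.piFinset fun _ => range N)).filter
      fun uv => StrictAnti uv.1 ∧ (∀ j, 0 < uv.1 j) ∧ (∀ j, 0 < uv.2 j) ∧
        (∑ j, uv.1 j * uv.2 j) = n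
  have hT : {uv : (Fin l → ℕ) × (Fin l → ℕ) | StrictAnti uv.1 ∧ (∀ j, 0 < uv.1 j) ∧
      (∀ j, 0 < uv.2 j) ∧ (∑ j, uv.1 j * uv.2 j) = n} = T := by
    ext ⟨u, v⟩
    simp only [T, Set.mem_ofPred_eq, coe_filter, mem_product, Fintype.mem_piFinset, mem_range]
    refine ⟨fun h => ⟨?_, h⟩, fun h => h.2⟩
    obtain ⟨-, hu, hv, hn⟩ := h
    have hle (j : Fin l) : u j * v j < N :=
      ((single_le_sum (fun i _ => Nat.zero_le (u i * v i)) (mem_univ j)).trans hn.le).trans_lt hN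
    exact ⟨fun j => (Nat.le_mul_of_pos_right _ (hv j)).trans_lt (hle j),
      fun j => (Nat.le_mul_of_pos_left _ (hu j)).trans_lt (hle j)⟩
  rw [biBracket, PowerSeries.coeff_mk, hT, finsum_mem_coe_finset, iteratedSum, map_sum]
  simp only [PowerSeries.coeff_prod]
  rw [← sum_product']
  symm
  refine sum_of_injOn
    (fun uv => (uv.1, Finsupp.equivFunOnFinite.symm fun j => uv.1 j * uv.2 j)) ?_ ?_ ?_ ?_
  · rintro ⟨u, v⟩ h ⟨u', v'⟩ - heq
    simp only [T, coe_filter, Set.mem_ofPred_eq] at h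
    simp only [Prod.mk.injEq, EmbeddingLike.apply_eq_iff_eq] at heq
    obtain ⟨rfl, heq⟩ := heq
    refine Prod.ext rfl (funext fun j => ?_)
    exact Nat.eq_of_mul_eq_mul_left (h.2.2.1 j) (congrFun heq j)
  · rintro ⟨u, v⟩ h
    simp only [T, coe_filter, Set.mem_ofPred_eq, mem_product] at h
    simp only [mem_coe, mem_product, mem_filter, mem_finsuppAntidiag]
    exact ⟨⟨h.1.1, h.2.1⟩, by simpa using h.2.2.2.2, subset_univ _⟩
  · rintro ⟨u, d⟩ hud hnot
    by_contra hne
    simp only [mem_product, mem_filter, Fintype.mem_piFinset, mem_range,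
      mem_finsuppAntidiag] at hud
    have hj (j : Fin l) := exists_eq_mul_of_coeff_biLetter_ne_zero
      (prod_ne_zero_iff.1 hne j (mem_univ j))
    choose hu v hv hd using hj
    refine hnot ⟨(u, v), ?_, Prod.ext rfl (Finsupp.ext fun j => (hd j).symm)⟩
    rw [← hT]
    refine ⟨hud.1.2, hu, hv, ?_⟩
    rw [← hud.2.1]
    exact sum_congr rfl fun j _ => (hd j).symm
  · rintro ⟨u, v⟩ h
    rw [← mem_coe, ← hT] at h
    exact prod_congr rfl fun j _ => (coeff_biLetter_mul (r j, s j - 1) (h.2.1 j) (h.2.2.1 j)).symm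

/-- The diagonal limit of a sequence of power series. -/
noncomputable def diagLimit : (ℕ → PowerSeries ℚ) →ₗ[ℚ] PowerSeries ℚ where
  toFun h := PowerSeries.mk fun n => PowerSeries.coeff n (h (n + 1))
  map_add' h k := by ext n; simp
  map_smul' c h := by ext n; simp

theorem diagLimit_iteratedSum {l : ℕ} (s r : Fin l → ℕ) :
    diagLimit (iteratedSum fun j => biLetter (r j, s j - 1)) = biBracket l s r := by
  ext n
  simpa [diagLimit] using coeff_iteratedSum_biLetter s r n.lt_succ_self

open Finset in
theorem diagLimit_iteratedSum_mul {l m : ℕ} (s r : Fin l → ℕ) (s' r' : Fin m → ℕ) :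
    diagLimit ((iteratedSum fun j => biLetter (r j, s j - 1)) *
      iteratedSum fun j => biLetter (r' j, s' j - 1)) = biBracket l s r * biBracket m s' r' := by
  ext n
  simp only [diagLimit, LinearMap.coe_mk, AddHom.coe_mk, PowerSeries.coeff_mk, Pi.mul_apply,
    PowerSeries.coeff_mul]
  refine sum_congr rfl fun p hp => ?_
  rw [HasAntidiagonal.mem_antidiagonal] at hp
  rw [coeff_iteratedSum_biLetter s r (by omega), coeff_iteratedSum_biLetter s' r' (by omega)]

theorem biBracket_zero (s r : Fin 0 → ℕ) : biBracket 0 s r = 1 := by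
  rw [← diagLimit_iteratedSum]
  ext n
  simp [diagLimit, iteratedSum_zero]

theorem biBracket_mem_span {l : ℕ} {s : Fin l → ℕ} (r : Fin l → ℕ) (hs : ∀ j, 1 ≤ s j) :
    biBracket l s r ∈ Submodule.span ℚ biBracketSet := by
  apply Submodule.subset_span
  rcases l with _ | l
  · exact Or.inl (biBracket_zero s r)
  · exact Or.inr ⟨l + 1, by omega, s, r, hs, rfl⟩

theorem exists_eq_biBracket_of_mem {f : PowerSeries ℚ} (hf : f ∈ biBracketSet) :
    ∃ (l : ℕ) (s r : Fin l → ℕ), f = biBracket l s r := by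
  rcases hf with rfl | ⟨l, -, s, r, -, rfl⟩
  · exact ⟨0, 0, 0, (biBracket_zero _ _).symm⟩
  · exact ⟨l, s, r, rfl⟩

theorem diagLimit_mem_span {h : ℕ → PowerSeries ℚ} (hh : h ∈ iteratedSpan biLetter) :
    diagLimit h ∈ Submodule.span ℚ biBracketSet := by
  suffices iteratedSpan biLetter ≤ (Submodule.span ℚ biBracketSet).comap diagLimit from this hh
  rw [iteratedSpan, Submodule.span_le]
  rintro _ ⟨⟨l, w⟩, rfl⟩
  have := diagLimit_iteratedSum (fun j => (w j).2 + 1) (fun j => (w j).1)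
  simp only [Nat.add_sub_cancel, Prod.mk.eta] at this
  simp only [Submodule.comap_coe, Set.mem_preimage, SetLike.mem_coe, this]
  exact biBracket_mem_span _ fun j => by omega

/-- The ℚ-span of `1` and all bi-brackets is closed under multiplication of formal
power series, i.e. it is a ℚ-subalgebra of `ℚ[[q]]`. -/
theorem biBracket_span_mul_closed (f g : PowerSeries ℚ)
    (hf : f ∈ Submodule.span ℚ biBracketSet)
    (hg : g ∈ Submodule.span ℚ biBracketSet) :
    f * g ∈ Submodule.span ℚ biBracketSet := by
  suffices Submodule.span ℚ biBracketSet * Submodule.span ℚ biBracketSet ≤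
      Submodule.span ℚ biBracketSet from this (Submodule.mul_mem_mul hf hg)
  rw [Submodule.span_mul_span, Submodule.span_le]
  rintro _ ⟨a, ha, b, hb, rfl⟩
  obtain ⟨l, s, r, rfl⟩ := exists_eq_biBracket_of_mem ha
  obtain ⟨m, s', r', rfl⟩ := exists_eq_biBracket_of_mem hb
  change biBracket l s r * biBracket m s' r' ∈ _
  rw [← diagLimit_iteratedSum_mul]
  exact diagLimit_mem_span (iteratedSum_mul_mem biLetter_mul_mem
    (fun j => (r j, s j - 1)) fun j => (r' j, s' j - 1))
end

section
/- (General partition relation.) Fix l ≥ 1, integers s₁,…,sₗ ≥ 1 and r₁,…,rₗ ≥ 0, and n ≥ 1. Let P_l(n) denote the set of pairs of tuples (u,v) = ((u₁,…,uₗ),(v₁,…,vₗ)) of positive integers with u₁ > u₂ > … > uₗ > 0 and u₁v₁ + … + uₗvₗ = n. Then, with the convention u_{l+1} := 0, Σ_{(u,v) ∈ P_l(n)} ∏_{j=1}^{l} u_j^{r_j} · v_j^{s_j−1} = Σ_{(u,v) ∈ P_l(n)} ∏_{j=1}^{l} (v₁ + v₂ + … + v_{l−j+1})^{r_j} · (u_{l−j+1}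 − u_{l−j+2})^{s_j−1}. -/
open scoped Nat

/-- `Pl l n` : the set of partitions of `n` with `l` distinct parts, encoded as pairs
`(u,v)` of `l`-tuples of positive integers with `u₁ > … > uₗ > 0` and `∑ uⱼvⱼ = n`. -/
def Pl (l n : ℕ) : Set ((Fin l → ℕ) × (Fin l → ℕ)) :=
  {uv | StrictAnti uv.1 ∧ (∀ j, 0 < uv.1 j) ∧ (∀ j, 0 < uv.2 j) ∧
    (∑ j, uv.1 j * uv.2 j) = n}

/-- Extension of an `l`-tuple to a sequence by zero. -/
def extendZero {l : ℕ} (u : Fin l → ℕ) (k : ℕ) : ℕ := if h : k < l then u ⟨k, h⟩ else 0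

lemma extendZero_val {l : ℕ} (u : Fin l → ℕ) (j : Fin l) : extendZero u j = u j := by
  simp [extendZero]

lemma extendZero_of_le {l : ℕ} (u : Fin l → ℕ) {k : ℕ} (hk : l ≤ k) : extendZero u k = 0 := by
  simp [extendZero, hk]

lemma extendZero_antitone {l : ℕ} {u : Fin l → ℕ} (hu : StrictAnti u) :
    Antitone (extendZero u) := by
  intro a b hab
  unfold extendZero
  split_ifs with hb ha
  · exact hu.antitone (by simpa using hab)
  · omega
  · exact Nat.zero_le _
  · exact le_rfl

lemma extendZero_succ_lt {l : ℕ} {u : Fin l → ℕ} (hu : StrictAnti u) (hpos : ∀ j, 0 < u j)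
    {k : ℕ} (hk : k < l) : extendZero u (k + 1) < extendZero u k := by
  unfold extendZero
  rw [dif_pos hk]
  split_ifs
  · exact hu (by simp)
  · exact hpos _

/-- Conjugation of a partition, in the encoding of `Pl`. -/
def conjPair {l : ℕ} (uv : (Fin l → ℕ) × (Fin l → ℕ)) : (Fin l → ℕ) × (Fin l → ℕ) :=
  (fun j => ∑ i ∈ Finset.range (l - j), extendZero uv.2 i,
    fun j => extendZero uv.1 (l - 1 - j) - extendZero uv.1 (l - j))

lemma extendZero_conjPair_fst {l : ℕ} (uv : (Fin l → ℕ) × (Fin l → ℕ)) (k : ℕ) :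
    extendZero (conjPair uv).1 k = ∑ i ∈ Finset.range (l - k), extendZero uv.2 i := by
  by_cases h : k < l
  · simp [extendZero, conjPair, h]
  · rw [extendZero_of_le _ (by omega), Nat.sub_eq_zero_of_le (by omega), Finset.sum_range_zero]

/-- Summation by parts for an antitone sequence of natural numbers. -/
lemma sum_partialSum_mul_sub {a : ℕ → ℕ} (ha : Antitone a) (v : ℕ → ℕ) (m : ℕ) :
    ∑ k ∈ Finset.range m, (∑ i ∈ Finset.range (k + 1), v i) * (a k - a (k + 1)) +
      (∑ i ∈ Finset.range m, v i) * a m = ∑ k ∈ Finset.range m, a k * v k := by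
  induction m with
  | zero => simp
  | succ m ih =>
    obtain ⟨d, hd⟩ := Nat.exists_eq_add_of_le (ha (Nat.le_succ m))
    rw [Finset.sum_range_succ _ m, Finset.sum_range_succ v m,
      Finset.sum_range_succ (fun k => a k * v k), ← ih]
    simp only [Nat.succ_eq_add_one] at hd
    rw [hd, Nat.add_sub_cancel_left]
    ring

lemma sum_conjPair {l : ℕ} {uv : (Fin l → ℕ) × (Fin l → ℕ)} (hu : StrictAnti uv.1) :
    ∑ j, (conjPair uv).1 j * (conjPair uv).2 j = ∑ j, uv.1 j * uv.2 j := by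
  have h := sum_partialSum_mul_sub (extendZero_antitone hu) (extendZero uv.2) l
  rw [extendZero_of_le uv.1 le_rfl, mul_zero, add_zero, ← Finset.sum_range_reflect,
    Finset.sum_range, Finset.sum_range] at h
  simp only [extendZero_val] at h
  rw [← h]
  refine Finset.sum_congr rfl fun j _ => ?_
  have hj : l - 1 - (j : ℕ) + 1 = l - j := by have := j.isLt; omega
  simp only [conjPair, hj]

lemma conjPair_mem {l n : ℕ} {uv : (Fin l → ℕ) × (Fin l → ℕ)} (h : uv ∈ Pl l n) :
    conjPair uv ∈ Pl l n := by
  obtain ⟨hu, hupos, hvpos, hsum⟩ := h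
  have hpos : ∀ k < l, 0 < extendZero uv.2 k := fun k hk => by
    simpa [extendZero, hk] using hvpos ⟨k, hk⟩
  refine ⟨fun i j hij => ?_, fun j => ?_, fun j => ?_, (sum_conjPair hu).trans hsum⟩
  · have hi := i.isLt
    have hij' : (i : ℕ) < j := hij
    refine Finset.sum_lt_sum_of_subset (i := l - j)
      (Finset.range_subset_range.2 (by omega)) (Finset.mem_range.2 (by omega)) (by simp)
      (hpos _ (by omega)) fun _ _ _ => Nat.zero_le _
  · have hj := j.isLt
    exact Finset.sum_pos (fun i hi => hpos i (by have := Finset.mem_range.1 hi; omega))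
      ⟨0, Finset.mem_range.2 (by omega)⟩
  · have hj := j.isLt
    have := extendZero_succ_lt hu hupos (k := l - 1 - j) (by omega)
    rw [show l - 1 - (j : ℕ) + 1 = l - j by omega] at this
    exact Nat.sub_pos_of_lt this

lemma sum_range_extendZero_conjPair_snd {l : ℕ} {uv : (Fin l → ℕ) × (Fin l → ℕ)}
    (hu : StrictAnti uv.1) {m : ℕ} (hm : m ≤ l) :
    ∑ i ∈ Finset.range m, extendZero (conjPair uv).2 i = extendZero uv.1 (l - m) := by
  induction m with
  | zero => simp [extendZero_of_le]
  | succ m ih =>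
    have hlt : m < l := hm
    have hle := extendZero_antitone hu (show l - (m + 1) ≤ l - m by omega)
    have hval := extendZero_val (conjPair uv).2 ⟨m, hlt⟩
    simp only [conjPair, Nat.sub_right_comm l 1 m] at hval
    rw [Finset.sum_range_succ, ih hlt.le]
    simp only [conjPair, hval]
    rw [Nat.sub_sub]
    omega

lemma conjPair_conjPair {l : ℕ} {uv : (Fin l → ℕ) × (Fin l → ℕ)} (hu : StrictAnti uv.1) :
    conjPair (conjPair uv) = uv := by
  refine Prod.ext (funext fun j => ?_) (funext fun j => ?_)
  · change ∑ i ∈ Finset.range (l - j), extendZero (conjPair uv).2 i = _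
    rw [sum_range_extendZero_conjPair_snd hu (Nat.sub_le _ _), Nat.sub_sub_self j.isLt.le,
      extendZero_val]
  · change extendZero (conjPair uv).1 _ - extendZero (conjPair uv).1 _ = _
    have hj := j.isLt
    rw [extendZero_conjPair_fst, extendZero_conjPair_fst, Nat.sub_sub_self hj.le,
      show l - (l - 1 - (j : ℕ)) = j + 1 by omega, Finset.sum_range_succ,
      Nat.add_sub_cancel_left, extendZero_val]

lemma bijOn_conjPair (l n : ℕ) : Set.BijOn conjPair (Pl l n) (Pl l n) :=
  Set.InvOn.bijOn (f' := conjPair)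
    ⟨fun _ h => conjPair_conjPair h.1, fun _ h => conjPair_conjPair h.1⟩
    (fun _ h => conjPair_mem h) (fun _ h => conjPair_mem h)

lemma sum_filter_eq_conjPair_fst {l : ℕ} (uv : (Fin l → ℕ) × (Fin l → ℕ)) (j : Fin l) :
    ∑ i ∈ Finset.univ.filter (fun i : Fin l => (i : ℕ) + (j : ℕ) < l), uv.2 i =
      (conjPair uv).1 j := by
  have hrange : Finset.range (l - j) = (Finset.range l).filter fun i => i + (j : ℕ) < l := by
    ext i
    simp only [Finset.mem_range, Finset.mem_filter]
    omega
  simp only [conjPair]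
  rw [hrange, Finset.sum_filter, Finset.sum_filter, Finset.sum_range]
  simp only [extendZero_val]

/-- The general partition relation: invariance of the weighted sums over partitions
under conjugation of partitions (with the convention `u_{l+1} = 0`). -/
theorem partition_relation (l : ℕ) (hl : 1 ≤ l) (s r : Fin l → ℕ)
    (hs : ∀ j, 1 ≤ s j) (n : ℕ) (hn : 1 ≤ n) :
    (∑ᶠ uv ∈ Pl l n, ∏ j : Fin l, uv.1 j ^ r j * uv.2 j ^ (s j - 1)) =
      ∑ᶠ uv ∈ Pl l n, ∏ j : Fin l,
        (∑ i ∈ Finset.univ.filter fun i : Fin l => (i : ℕ) + (j : ℕ) < l, uv.2 i) ^ r j *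
          ((if h : l - 1 - (j : ℕ) < l then uv.1 ⟨l - 1 - (j : ℕ), h⟩ else 0) -
            (if h : l - (j : ℕ) < l then uv.1 ⟨l - (j : ℕ), h⟩ else 0)) ^ (s j - 1) := by
  refine (finsum_mem_eq_of_bijOn conjPair (bijOn_conjPair l n) fun uv _ => ?_).symm
  refine Finset.prod_congr rfl fun j _ => ?_
  rw [sum_filter_eq_conjPair_fst]
  rfl
end

section
/- (Partition relation in length one.) For all integers s ≥ 1 and r ≥ 0, the bi-brackets satisfy [s; r] = [r+1; s−1] as formal power series in ℚ[[q]]. -/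
open scoped Nat

/-- Partition relation in length one: `[s; r] = [r+1; s−1]`. -/
theorem biBracket_partition_length_one (s r : ℕ) (hs : 1 ≤ s) :
    biBracket 1 (fun _ => s) (fun _ => r) =
      biBracket 1 (fun _ => r + 1) (fun _ => s - 1) := by
  ext n
  simp only [biBracket, PowerSeries.coeff_mk]
  have swap_mapsTo : Set.MapsTo Prod.swap
      {uv : (Fin 1 → ℕ) × (Fin 1 → ℕ) |
        StrictAnti uv.1 ∧ (∀ j, 0 < uv.1 j) ∧ (∀ j, 0 < uv.2 j) ∧ (∑ j, uv.1 j * uv.2 j) = n}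
      {uv : (Fin 1 → ℕ) × (Fin 1 → ℕ) |
        StrictAnti uv.1 ∧ (∀ j, 0 < uv.1 j) ∧ (∀ j, 0 < uv.2 j) ∧
          (∑ j, uv.1 j * uv.2 j) = n} := by
    rintro ⟨u, v⟩ ⟨-, hu, hv, huv⟩
    refine ⟨Subsingleton.strictAnti v, hv, hu, ?_⟩
    simpa only [Prod.fst_swap, Prod.snd_swap, mul_comm] using huv
  refine finsum_mem_eq_of_bijOn Prod.swap
    (Set.InvOn.bijOn ⟨fun x _ => Prod.swap_swap x, fun x _ => Prod.swap_swap x⟩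
      swap_mapsTo swap_mapsTo) fun uv _ => ?_
  simp only [Prod.fst_swap, Prod.snd_swap, Nat.add_sub_cancel, mul_comm]
end

section
/- (Partition relation in length two.) For all integers s₁, s₂ ≥ 1 and r₁, r₂ ≥ 0, the bi-brackets satisfy [s₁,s₂; r₁,r₂] = Σ_{0 ≤ j ≤ r₁} Σ_{0 ≤ k ≤ s₂−1} (−1)^k · C(s₁−1+k, k) · C(r₂+j, j) · [r₂+j+1, r₁−j+1; s₂−1−k, s₁−1+k] as formal power series in ℚ[[q]], where C(a,b) denotes the binomial coefficient. -/
open scoped Nat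

/-- The index set of the sum defining the `n`-th coefficient of a bi-bracket of length `l`. -/
def biBracketIndex (l n : ℕ) : Set ((Fin l → ℕ) × (Fin l → ℕ)) :=
  {uv | StrictAnti uv.1 ∧ (∀ j, 0 < uv.1 j) ∧ (∀ j, 0 < uv.2 j) ∧
    (∑ j, uv.1 j * uv.2 j) = n}

theorem finite_biBracketIndex (l n : ℕ) : (biBracketIndex l n).Finite := by
  refine ((Set.finite_Icc 0 fun _ => n).prod (Set.finite_Icc 0 fun _ => n)).subset ?_
  rintro ⟨u, v⟩ ⟨-, hu, hv, hn⟩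
  have key : ∀ j, u j * v j ≤ n := fun j => hn ▸
    Finset.single_le_sum (f := fun j => u j * v j) (fun _ _ => Nat.zero_le _) (Finset.mem_univ j)
  exact ⟨⟨fun j => Nat.zero_le _, fun j => (Nat.le_mul_of_pos_right _ (hv j)).trans (key j)⟩,
    fun j => Nat.zero_le _, fun j => (Nat.le_mul_of_pos_left _ (hu j)).trans (key j)⟩

theorem coeff_biBracket (l : ℕ) (s r : Fin l → ℕ) (n : ℕ) :
    PowerSeries.coeff n (biBracket l s r) =
      ∑ uv ∈ (finite_biBracketIndex l n).toFinset,
        ∏ j, ((uv.1 j : ℚ) ^ r j / (r j)!) * ((uv.2 j : ℚ) ^ (s j - 1) / ((s j - 1)!)) := by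
  rw [biBracket, PowerSeries.coeff_mk]
  exact finsum_mem_eq_finite_toFinset_sum _ (finite_biBracketIndex l n)

theorem mem_biBracketIndex_two {n : ℕ} {uv : (Fin 2 → ℕ) × (Fin 2 → ℕ)} :
    uv ∈ biBracketIndex 2 n ↔
      uv.1 1 < uv.1 0 ∧ 0 < uv.1 1 ∧ 0 < uv.2 0 ∧ 0 < uv.2 1 ∧
        uv.1 0 * uv.2 0 + uv.1 1 * uv.2 1 = n := by
  simp only [biBracketIndex, Set.mem_ofPred_eq, Fin.strictAnti_iff_succ_lt, Fin.forall_fin_one,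
    Fin.forall_fin_two, Fin.sum_univ_two, Fin.castSucc_zero, Fin.succ_zero_eq_one]
  constructor
  · tauto
  · rintro ⟨h, h₁, h₂, h₃, h₄⟩
    exact ⟨h, ⟨h₁.trans h, h₁⟩, ⟨h₂, h₃⟩, h₄⟩

/-- Conjugation of partitions with two distinct part sizes, with `u` the part sizes and `v` the
multiplicities. -/
def conjugateTwo (uv : (Fin 2 → ℕ) × (Fin 2 → ℕ)) : (Fin 2 → ℕ) × (Fin 2 → ℕ) :=
  (![uv.2 0 + uv.2 1, uv.2 0], ![uv.1 1, uv.1 0 - uv.1 1])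

theorem conjugateTwo_mem {n : ℕ} {uv : (Fin 2 → ℕ) × (Fin 2 → ℕ)}
    (h : uv ∈ biBracketIndex 2 n) : conjugateTwo uv ∈ biBracketIndex 2 n := by
  rw [mem_biBracketIndex_two] at h ⊢
  obtain ⟨h₀, h₁, h₂, h₃, h₄⟩ := h
  obtain ⟨d, hd⟩ := Nat.exists_eq_add_of_lt h₀
  simp only [conjugateTwo, Matrix.cons_val_zero, Matrix.cons_val_one]
  refine ⟨by omega, h₂, h₁, by omega, ?_⟩
  rw [← h₄, show uv.1 0 - uv.1 1 = d + 1 by omega, hd]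
  ring

theorem conjugateTwo_conjugateTwo {n : ℕ} {uv : (Fin 2 → ℕ) × (Fin 2 → ℕ)}
    (h : uv ∈ biBracketIndex 2 n) : conjugateTwo (conjugateTwo uv) = uv := by
  rw [mem_biBracketIndex_two] at h
  ext j <;> fin_cases j <;> simp [conjugateTwo]
  omega

theorem add_pow_div_factorial (x y : ℚ) (m : ℕ) :
    (x + y) ^ m / m ! = ∑ j ∈ Finset.range (m + 1), x ^ j / j ! * (y ^ (m - j) / (m - j)!) := by
  rw [add_pow, Finset.sum_div]
  refine Finset.sum_congr rfl fun j hj => ?_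
  rw [Nat.cast_choose ℚ (Finset.mem_range_succ_iff.mp hj)]
  field_simp

theorem choose_mul_pow_div_factorial (x : ℚ) (a k : ℕ) :
    ((a + k).choose k : ℚ) * (x ^ (a + k) / (a + k)!) = x ^ a / a ! * (x ^ k / k !) := by
  rw [add_comm a k, Nat.cast_add_choose, pow_add]
  field_simp

/-- Partition relation in length two. -/
theorem biBracket_partition_length_two (s₁ s₂ r₁ r₂ : ℕ) (h₁ : 1 ≤ s₁) (h₂ : 1 ≤ s₂) :
    biBracket 2 ![s₁, s₂] ![r₁, r₂] =
      ∑ j ∈ Finset.range (r₁ + 1), ∑ k ∈ Finset.range s₂,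
        ((-1 : ℚ) ^ k * ((s₁ - 1 + k).choose k : ℚ) * ((r₂ + j).choose j : ℚ)) •
          biBracket 2 ![r₂ + j + 1, r₁ - j + 1] ![s₂ - 1 - k, s₁ - 1 + k] := by
  obtain ⟨a, rfl⟩ := Nat.exists_eq_add_of_le' h₁
  obtain ⟨b, rfl⟩ := Nat.exists_eq_add_of_le' h₂
  ext n
  simp only [map_sum, PowerSeries.coeff_smul, coeff_biBracket, smul_eq_mul, Finset.mul_sum,
    Fin.prod_univ_two, Matrix.cons_val_zero, Matrix.cons_val_one, Nat.add_sub_cancel]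
  rw [Finset.sum_congr rfl fun _ _ => Finset.sum_comm, Finset.sum_comm]
  refine Finset.sum_nbij' conjugateTwo conjugateTwo ?_ ?_ ?_ ?_ ?_
  · simpa using fun u v => conjugateTwo_mem (uv := (u, v))
  · simpa using fun u v => conjugateTwo_mem (uv := (u, v))
  · simpa using fun u v => conjugateTwo_conjugateTwo (uv := (u, v))
  · simpa using fun u v => conjugateTwo_conjugateTwo (uv := (u, v))
  rintro ⟨u, v⟩ huv
  have hlt := (mem_biBracketIndex_two.mp ((Set.Finite.mem_toFinset _).mp huv)).1
  simp only [conjugateTwo, Matrix.cons_val_zero, Matrix.cons_val_one, Nat.cast_add,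
    Nat.cast_sub hlt.le]
  have hu := add_pow_div_factorial (u 1 : ℚ) (u 0 - u 1) r₁
  have hv := add_pow_div_factorial (-v 0 : ℚ) (v 0 + v 1) b
  rw [add_sub_cancel] at hu
  rw [neg_add_cancel_left] at hv
  simp only [hu, hv, Finset.sum_mul, Finset.mul_sum]
  rw [Finset.sum_comm]
  refine Finset.sum_congr rfl fun j _ => Finset.sum_congr rfl fun k _ => ?_
  rw [neg_pow]
  linear_combination
    -((-1 : ℚ) ^ k * ((v 0 + v 1) ^ (b - k) / (b - k)!) * ((u 0 - u 1) ^ (r₁ - j) / (r₁ - j)!)) *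
      (((r₂ + j).choose j * ((u 1 : ℚ) ^ (r₂ + j) / (r₂ + j)!)) *
          choose_mul_pow_div_factorial (v 0 : ℚ) a k +
        ((v 0 : ℚ) ^ a / a ! * ((v 0 : ℚ) ^ k / k !)) *
          choose_mul_pow_div_factorial (u 1 : ℚ) r₂ j)
end

section
/- (Stuffle product for bi-brackets in length one.) For all integers s₁, s₂ ≥ 1 and r₁, r₂ ≥ 0 we have, in ℚ[[q]]: [s₁; r₁] · [s₂; r₂] = [s₁,s₂; r₁,r₂] + [s₂,s₁; r₂,r₁] + C(r₁+r₂, r₁)·[s₁+s₂; r₁+r₂] + C(r₁+r₂, r₁) · Σ_{j=1}^{s₁} (−1)^{s₂−1} · (B_{s₁+s₂−j}/(s₁+s₂−j)!) · C(s₁+s₂−j−1, s₁−j) · [j; r₁+r₂] + C(r₁+r₂, r₁) · Σ_{j=1}^{s₂} (−1)^{s₁−1} · (B_{s₁+s₂−j}/(s₁+s₂−j)!) · C(s₁+s₂−j−1, s₂−j) · [j; r₁+r₂], where C(a,b) is the binomial coefficient. -/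
open scoped Nat

open Finset in
/-- The quadruples `((u₁, v₁), (u₂, v₂))` of positive integers with `u₁v₁ + u₂v₂ = n`. -/
def posQuadruples (n : ℕ) : Finset ((ℕ × ℕ) × (ℕ × ℕ)) :=
  (((range (n + 1)) ×ˢ (range (n + 1))) ×ˢ ((range (n + 1)) ×ˢ (range (n + 1)))).filter
    fun e => 0 < e.1.1 ∧ 0 < e.1.2 ∧ 0 < e.2.1 ∧ 0 < e.2.2 ∧
      e.1.1 * e.1.2 + e.2.1 * e.2.2 = n

theorem mem_posQuadruples {n : ℕ} {e : (ℕ × ℕ) × (ℕ × ℕ)} :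
    e ∈ posQuadruples n ↔ 0 < e.1.1 ∧ 0 < e.1.2 ∧ 0 < e.2.1 ∧ 0 < e.2.2 ∧
      e.1.1 * e.1.2 + e.2.1 * e.2.2 = n := by
  obtain ⟨⟨a, b⟩, c, d⟩ := e
  simp only [posQuadruples, Finset.mem_filter, Finset.mem_product, Finset.mem_range,
    and_iff_right_iff_imp]
  rintro ⟨ha, hb, hc, hd, h⟩
  have h1 := Nat.le_mul_of_pos_right a hb
  have h2 := Nat.le_mul_of_pos_left b ha
  have h3 := Nat.le_mul_of_pos_right c hd
  have h4 := Nat.le_mul_of_pos_left d hc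
  omega

/-- The weight of a pair `(u, v)` in the bi-bracket `[s; r]`. -/
def biWeight (s r : ℕ) (x : ℕ × ℕ) : ℚ :=
  ((x.1 : ℚ) ^ r / r !) * ((x.2 : ℚ) ^ (s - 1) / (s - 1)!)

theorem coeff_biBracket_one (s r n : ℕ) :
    PowerSeries.coeff n (biBracket 1 ![s] ![r]) =
      ∑ x ∈ n.divisorsAntidiagonal with n ≠ 0, biWeight s r x := by
  rw [biBracket, PowerSeries.coeff_mk, ← finsum_mem_coe_finset]
  refine finsum_mem_eq_of_bijOn (fun uv => (uv.1 0, uv.2 0)) ⟨?_, ?_, ?_⟩ ?_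
  · rintro ⟨u, v⟩ ⟨-, hu, hv, h⟩
    simp only [Fin.sum_univ_one] at h
    have := Nat.mul_pos (hu 0) (hv 0)
    simp only at this
    simp only [Finset.coe_filter, Nat.mem_divisorsAntidiagonal, Set.mem_ofPred_eq]
    omega
  · rintro ⟨u, v⟩ - ⟨u', v'⟩ - h
    simp only [Prod.mk.injEq] at h
    ext j <;> fin_cases j <;> simp [h.1, h.2]
  · rintro ⟨u, v⟩ h
    simp only [Finset.coe_filter, Nat.mem_divisorsAntidiagonal, Set.mem_ofPred_eq] at h
    obtain ⟨⟨rfl, h0⟩, -⟩ := h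
    have hu : 0 < u := Nat.pos_of_ne_zero (by rintro rfl; simp at h0)
    have hv : 0 < v := Nat.pos_of_ne_zero (by rintro rfl; simp at h0)
    exact ⟨(![u], ![v]), ⟨Subsingleton.strictAnti _, by simpa, by simpa, by simp⟩, by simp⟩
  · rintro ⟨u, v⟩ -
    simp [biWeight]

theorem coeff_biBracket_two (s₁ s₂ r₁ r₂ n : ℕ) :
    PowerSeries.coeff n (biBracket 2 ![s₁, s₂] ![r₁, r₂]) =
      ∑ e ∈ posQuadruples n with e.2.1 < e.1.1, biWeight s₁ r₁ e.1 * biWeight s₂ r₂ e.2 := by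
  rw [biBracket, PowerSeries.coeff_mk, ← finsum_mem_coe_finset]
  refine finsum_mem_eq_of_bijOn (fun uv => ((uv.1 0, uv.2 0), (uv.1 1, uv.2 1))) ⟨?_, ?_, ?_⟩ ?_
  · rintro ⟨u, v⟩ ⟨hs, hu, hv, h⟩
    simp only [Fin.sum_univ_two] at h
    simp only [Finset.coe_filter, mem_posQuadruples, Set.mem_ofPred_eq]
    exact ⟨⟨hu 0, hv 0, hu 1, hv 1, h⟩, hs (by decide)⟩
  · rintro ⟨u, v⟩ - ⟨u', v'⟩ - h
    simp only [Prod.mk.injEq] at h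
    ext j <;> fin_cases j <;> simp [h.1, h.2]
  · rintro ⟨⟨u, v⟩, u', v'⟩ h
    simp only [Finset.coe_filter, mem_posQuadruples, Set.mem_ofPred_eq] at h
    obtain ⟨⟨hu, hv, hu', hv', h⟩, hlt⟩ := h
    refine ⟨(![u, u'], ![v, v']), ⟨?_, ?_, ?_, ?_⟩, by simp⟩
    · intro i j hij
      fin_cases i <;> fin_cases j <;> simp_all
    · simp [Fin.forall_fin_two, hu, hu']
    · simp [Fin.forall_fin_two, hv, hv']
    · simpa [Fin.sum_univ_two] using h
  · rintro ⟨u, v⟩ -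
    simp [biWeight, Fin.prod_univ_two]

theorem coeff_biBracket_one_mul (s₁ s₂ r₁ r₂ n : ℕ) :
    PowerSeries.coeff n (biBracket 1 ![s₁] ![r₁] * biBracket 1 ![s₂] ![r₂]) =
      ∑ e ∈ posQuadruples n, biWeight s₁ r₁ e.1 * biWeight s₂ r₂ e.2 := by
  rw [PowerSeries.coeff_mul]
  simp only [coeff_biBracket_one, Finset.sum_mul_sum, ← Finset.sum_product']
  rw [Finset.sum_sigma']
  refine Finset.sum_nbij' (fun z => z.2)
    (fun e => ⟨(e.1.1 * e.1.2, e.2.1 * e.2.2), e⟩) ?_ ?_ ?_ ?_ ?_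
  · rintro ⟨⟨k, l⟩, ⟨a, b⟩, c, d⟩ h
    simp only [Finset.mem_sigma, Finset.HasAntidiagonal.mem_antidiagonal,
      Finset.mem_product, Finset.mem_filter, Nat.mem_divisorsAntidiagonal] at h
    obtain ⟨h, ⟨⟨rfl, hk⟩, -⟩, ⟨rfl, hl⟩, -⟩ := h
    simp only [ne_eq, mul_eq_zero, not_or] at hk hl h
    simp only [mem_posQuadruples]
    omega
  · rintro ⟨⟨a, b⟩, c, d⟩ h
    simp only [mem_posQuadruples] at h
    obtain ⟨ha, hb, hc, hd, h⟩ := h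
    simp [h, ha.ne', hb.ne', hc.ne', hd.ne']
  · rintro ⟨⟨k, l⟩, ⟨a, b⟩, c, d⟩ h
    simp only [Finset.mem_sigma, Finset.HasAntidiagonal.mem_antidiagonal,
      Finset.mem_product, Finset.mem_filter, Nat.mem_divisorsAntidiagonal] at h
    obtain ⟨h, ⟨⟨rfl, hk⟩, -⟩, ⟨rfl, hl⟩, -⟩ := h
    rfl
  · intros; rfl
  · intros; rfl

/-- The convolution `∑ x^a/a! · y^b/b!` over positive integers with `x + y = v`. -/
def powConv (a b v : ℕ) : ℚ :=
  ∑ p ∈ Finset.HasAntidiagonal.antidiagonal v with 0 < p.1 ∧ 0 < p.2,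
    ((p.1 : ℚ) ^ a / a !) * ((p.2 : ℚ) ^ b / b !)

theorem sum_posQuadruples_diag (s₁ s₂ r₁ r₂ n : ℕ) :
    ∑ e ∈ posQuadruples n with e.1.1 = e.2.1, biWeight s₁ r₁ e.1 * biWeight s₂ r₂ e.2 =
      ∑ x ∈ n.divisorsAntidiagonal with n ≠ 0,
        ((r₁ + r₂).choose r₁ : ℚ) * (((x.1 : ℚ) ^ (r₁ + r₂) / (r₁ + r₂)!) *
          powConv (s₁ - 1) (s₂ - 1) x.2) := by
  simp only [powConv, Finset.mul_sum]
  rw [Finset.sum_sigma']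
  refine Finset.sum_nbij' (fun e => ⟨(e.1.1, e.1.2 + e.2.2), (e.1.2, e.2.2)⟩)
    (fun z => ((z.1.1, z.2.1), (z.1.1, z.2.2))) ?_ ?_ ?_ ?_ ?_
  · rintro ⟨⟨a, b⟩, c, d⟩ h
    simp only [Finset.mem_filter, mem_posQuadruples] at h
    obtain ⟨⟨ha, hb, hc, hd, h⟩, rfl⟩ := h
    have : n ≠ 0 := by
      have := Nat.mul_pos ha hb
      omega
    simp [mul_add, h, this, hb, hd]
  · rintro ⟨⟨u, v⟩, a, b⟩ h
    simp only [Finset.mem_sigma, Finset.mem_filter, Finset.HasAntidiagonal.mem_antidiagonal,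
      Nat.mem_divisorsAntidiagonal] at h
    obtain ⟨⟨⟨h, hn⟩, -⟩, rfl, ha, hb⟩ := h
    have hu : 0 < u := Nat.pos_of_ne_zero (by rintro rfl; simp at h; omega)
    simp [mem_posQuadruples, ha, hb, hu, ← h, mul_add]
  · rintro ⟨⟨a, b⟩, c, d⟩ h
    simp only [Finset.mem_filter] at h
    simp [h.2]
  · rintro ⟨⟨u, v⟩, a, b⟩ h
    simp only [Finset.mem_sigma, Finset.mem_filter, Finset.HasAntidiagonal.mem_antidiagonal] at h
    obtain ⟨-, rfl, -⟩ := h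
    rfl
  · rintro ⟨⟨a, b⟩, c, d⟩ h
    simp only [Finset.mem_filter] at h
    obtain ⟨-, rfl⟩ := h
    have h := Nat.add_choose_mul_factorial_mul_factorial r₁ r₂
    rw [← Nat.choose_symm_add] at h
    have h' : ((r₁ + r₂).choose r₁ : ℚ) * r₁ ! * r₂ ! = (r₁ + r₂)! := by exact_mod_cast h
    have hc : ((r₁ + r₂).choose r₁ : ℚ) ≠ 0 := by
      exact_mod_cast (Nat.choose_pos (Nat.le_add_right _ _)).ne'
    simp only [biWeight]
    rw [← h']
    field_simp
    ring

theorem add_one_mul_powConv (a b v : ℕ) :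
    (a + 1 : ℚ) * powConv (a + 1) b v + (b + 1) * powConv a (b + 1) v = v * powConv a b v := by
  simp only [powConv, Finset.mul_sum, ← Finset.sum_add_distrib]
  refine Finset.sum_congr rfl ?_
  rintro ⟨x, y⟩ h
  simp only [Finset.mem_filter, Finset.HasAntidiagonal.mem_antidiagonal] at h
  obtain ⟨rfl, -⟩ := h
  push_cast [Nat.factorial_succ]
  field_simp
  ring

/-- The Bernoulli part of the polynomial evaluating `powConv`. -/
def bernoulliConv (a b : ℕ) (x : ℚ) : ℚ :=
  (-1) ^ b * ∑ p ∈ Finset.HasAntidiagonal.antidiagonal a,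
    bernoulli (p.1 + b + 1) / (p.1 + b + 1)! * ((p.1 + b).choose b : ℚ) * (x ^ p.2 / (p.2)!)

theorem add_one_mul_bernoulliConv (a b : ℕ) (x : ℚ) :
    (a + 1 : ℚ) * bernoulliConv (a + 1) b x + (b + 1) * bernoulliConv a (b + 1) x =
      x * bernoulliConv a b x := by
  have key : (a + 1 : ℚ) * ∑ p ∈ Finset.HasAntidiagonal.antidiagonal (a + 1),
      bernoulli (p.1 + b + 1) / (p.1 + b + 1)! * ((p.1 + b).choose b : ℚ) * (x ^ p.2 / (p.2)!) =
      ∑ p ∈ Finset.HasAntidiagonal.antidiagonal (a + 1), (p.1 : ℚ) *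
        (bernoulli (p.1 + b + 1) / (p.1 + b + 1)! *
        ((p.1 + b).choose b : ℚ) * (x ^ p.2 / (p.2)!)) +
      ∑ p ∈ Finset.HasAntidiagonal.antidiagonal (a + 1), (p.2 : ℚ) *
        (bernoulli (p.1 + b + 1) / (p.1 + b + 1)! *
        ((p.1 + b).choose b : ℚ) * (x ^ p.2 / (p.2)!)) := by
    rw [← Finset.sum_add_distrib, Finset.mul_sum]
    refine Finset.sum_congr rfl fun p hp => ?_
    have : ((p.1 : ℚ) + p.2) = a + 1 := by
      exact_mod_cast Finset.HasAntidiagonal.mem_antidiagonal.1 hp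
    rw [← this, add_mul]
  have hsub : ∑ p ∈ Finset.HasAntidiagonal.antidiagonal a, ((p.1 + 1 : ℕ) : ℚ) *
      (bernoulli (p.1 + 1 + b + 1) / (p.1 + 1 + b + 1)! * ((p.1 + 1 + b).choose b : ℚ) *
        (x ^ p.2 / (p.2)!)) =
      (b + 1) * ∑ p ∈ Finset.HasAntidiagonal.antidiagonal a,
        bernoulli (p.1 + (b + 1) + 1) / (p.1 + (b + 1) + 1)! *
          ((p.1 + (b + 1)).choose (b + 1) : ℚ) * (x ^ p.2 / (p.2)!) := by
    rw [Finset.mul_sum]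
    refine Finset.sum_congr rfl fun p _ => ?_
    have h := Nat.choose_succ_right_eq (p.1 + 1 + b) b
    rw [show p.1 + 1 + b - b = p.1 + 1 by omega] at h
    have h' : ((p.1 + 1 + b).choose (b + 1) : ℚ) * (b + 1 : ℕ) =
        (p.1 + 1 + b).choose b * (p.1 + 1 : ℕ) := by exact_mod_cast h
    rw [show p.1 + (b + 1) = p.1 + 1 + b by ring]
    push_cast at h' ⊢
    linear_combination (-(bernoulli (p.1 + 1 + b + 1) / (p.1 + 1 + b + 1)! *
      (x ^ p.2 / (p.2)!))) * h'
  have hmul : ∑ p ∈ Finset.HasAntidiagonal.antidiagonal a, ((p.2 + 1 : ℕ) : ℚ) *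
      (bernoulli (p.1 + b + 1) / (p.1 + b + 1)! * ((p.1 + b).choose b : ℚ) *
        (x ^ (p.2 + 1) / (p.2 + 1)!)) =
      x * ∑ p ∈ Finset.HasAntidiagonal.antidiagonal a,
        bernoulli (p.1 + b + 1) / (p.1 + b + 1)! * ((p.1 + b).choose b : ℚ) *
          (x ^ p.2 / (p.2)!) := by
    rw [Finset.mul_sum]
    refine Finset.sum_congr rfl fun p _ => ?_
    rw [Nat.factorial_succ p.2]
    push_cast
    field_simp
    ring
  rw [Finset.Nat.sum_antidiagonal_succ (f := fun p : ℕ × ℕ => (p.1 : ℚ) * _),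
    Finset.Nat.sum_antidiagonal_succ' (f := fun p : ℕ × ℕ => (p.2 : ℚ) * _)] at key
  simp only [hsub, hmul, Nat.cast_zero, zero_mul, zero_add] at key
  simp only [bernoulliConv, pow_succ (-1 : ℚ) b]
  linear_combination (-1) ^ b * key

theorem powConv_zero_right (a w : ℕ) :
    powConv a 0 (w + 1) = (w + 1 : ℚ) ^ (a + 1) / (a + 1)! + bernoulliConv a 0 (w + 1) +
      bernoulliConv 0 a (w + 1) := by
  have hconv : powConv a 0 (w + 1) = (∑ k ∈ Finset.range w, (k + 1 : ℚ) ^ a) / a ! := by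
    rw [powConv, Finset.sum_filter, Finset.Nat.sum_antidiagonal_eq_sum_range_succ_mk,
      Finset.sum_range_succ, Finset.sum_range_succ', Finset.sum_div]
    simp only [lt_self_iff_false, false_and, and_false, if_false, add_zero, Nat.sub_self]
    refine Finset.sum_congr rfl fun k hk => ?_
    rw [if_pos (by have := Finset.mem_range.1 hk; omega)]
    simp
  have hpow := sum_range_pow (w + 1) a
  rw [Finset.sum_range_succ', Finset.sum_range_succ'] at hpow
  have hterm : (∑ i ∈ Finset.range a, bernoulli (i + 1) * ((a + 1).choose (i + 1) : ℚ) *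
      ((w + 1 : ℕ) : ℚ) ^ (a + 1 - (i + 1)) / (a + 1)) / a ! =
      ∑ i ∈ Finset.range a, bernoulli (i + 1) / (i + 1)! *
        ((w + 1 : ℚ) ^ (a - i) / (a - i)!) := by
    rw [Finset.sum_div]
    refine Finset.sum_congr rfl fun i hi => ?_
    have hi' := Finset.mem_range.1 hi
    rw [Nat.cast_choose ℚ (by omega), Nat.factorial_succ a, Nat.add_sub_add_right]
    push_cast
    field_simp
  have hlast : bernoulli (a + 1) / (a + 1)! + (-1) ^ a * (bernoulli (a + 1) / (a + 1)!) =
      -(0 ^ a / a ! : ℚ) := by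
    rcases Nat.eq_zero_or_pos a with rfl | ha
    · norm_num [bernoulli_one]
    · rcases Nat.even_or_odd a with he | ho
      · rw [bernoulli_eq_zero_of_odd he.add_one (by omega), zero_pow ha.ne']
        simp
      · rw [ho.neg_one_pow, zero_pow ha.ne']
        simp
  have h₁ : bernoulliConv a 0 (w + 1) = ∑ i ∈ Finset.range a, bernoulli (i + 1) / (i + 1)! *
      ((w + 1 : ℚ) ^ (a - i) / (a - i)!) + bernoulli (a + 1) / (a + 1)! := by
    rw [bernoulliConv, Finset.Nat.sum_antidiagonal_eq_sum_range_succ_mk, Finset.sum_range_succ]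
    simp
  have h₂ : bernoulliConv 0 a (w + 1) = (-1) ^ a * (bernoulli (a + 1) / (a + 1)!) := by
    simp [bernoulliConv]
  rw [hconv, h₁, h₂, ← hterm]
  have hf : (w + 1 : ℚ) ^ (a + 1) / (a + 1)! = (w + 1 : ℚ) ^ (a + 1) / (a + 1) / a ! := by
    rw [Nat.factorial_succ]
    push_cast
    field_simp
  rw [hf]
  simp only [bernoulli_zero, Nat.choose_zero_right, Nat.cast_add, Nat.cast_one, Nat.cast_zero,
    Nat.sub_zero, one_mul, mul_one] at hpow ⊢
  linear_combination hpow / (a ! : ℚ) - hlast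

theorem powConv_eq (a b w : ℕ) :
    powConv a b (w + 1) = (w + 1 : ℚ) ^ (a + b + 1) / (a + b + 1)! + bernoulliConv a b (w + 1) +
      bernoulliConv b a (w + 1) := by
  induction b generalizing a with
  | zero => exact powConv_zero_right a w
  | succ b ih =>
    have hb : (b + 1 : ℚ) ≠ 0 := by positivity
    refine mul_left_cancel₀ hb ?_
    have h := add_one_mul_powConv a b (w + 1)
    have h₁ := add_one_mul_bernoulliConv a b (w + 1)
    have h₂ := add_one_mul_bernoulliConv b a (w + 1)
    rw [ih, ih] at h
    have h₃ : (w + 1 : ℚ) * ((w + 1 : ℚ) ^ (a + b + 1) / (a + b + 1)!) =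
        (a + b + 2) * ((w + 1 : ℚ) ^ (a + b + 1 + 1) / (a + b + 1 + 1)!) := by
      rw [Nat.factorial_succ (a + b + 1)]
      push_cast
      field_simp
      ring
    rw [show a + 1 + b + 1 = a + b + 1 + 1 by ring] at h
    rw [show a + (b + 1) + 1 = a + b + 1 + 1 by ring]
    push_cast at h
    linear_combination h + h₃ - h₁ - h₂

theorem bernoulliConv_eq_sum_Icc (s₁ s₂ : ℕ) (h₁ : 1 ≤ s₁) (h₂ : 1 ≤ s₂) (x : ℚ) :
    bernoulliConv (s₁ - 1) (s₂ - 1) x = ∑ j ∈ Finset.Icc 1 s₁,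
      ((-1 : ℚ) ^ (s₂ - 1) * (bernoulli (s₁ + s₂ - j) / ((s₁ + s₂ - j)! : ℚ)) *
        ((s₁ + s₂ - j - 1).choose (s₁ - j) : ℚ)) * (x ^ (j - 1) / (j - 1)!) := by
  obtain ⟨a, rfl⟩ := Nat.exists_eq_add_of_le' h₁
  obtain ⟨b, rfl⟩ := Nat.exists_eq_add_of_le' h₂
  simp only [bernoulliConv, Finset.mul_sum, Nat.add_sub_cancel]
  refine Finset.sum_nbij' (fun p => p.2 + 1) (fun j => (a + 1 - j, j - 1)) ?_ ?_ ?_ ?_ ?_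
  · rintro ⟨n, i⟩ h
    simp only [Finset.HasAntidiagonal.mem_antidiagonal] at h
    simp only [Finset.mem_Icc]
    omega
  · intro j h
    simp only [Finset.mem_Icc] at h
    simp only [Finset.HasAntidiagonal.mem_antidiagonal]
    omega
  · rintro ⟨n, i⟩ h
    simp only [Finset.HasAntidiagonal.mem_antidiagonal] at h
    simp only [Prod.mk.injEq]
    omega
  · intro j h
    simp only [Finset.mem_Icc] at h
    omega
  · rintro ⟨n, i⟩ h
    simp only [Finset.HasAntidiagonal.mem_antidiagonal] at h
    subst h
    simp only [Nat.add_sub_cancel]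
    rw [show n + i + 1 + (b + 1) - (i + 1) = n + b + 1 by omega,
      show n + i + 1 - (i + 1) = n by omega, Nat.add_sub_cancel, Nat.choose_symm_add]
    ring

/-- Stuffle product for bi-brackets in length one. -/
theorem biBracket_stuffle_length_one (s₁ s₂ r₁ r₂ : ℕ) (h₁ : 1 ≤ s₁) (h₂ : 1 ≤ s₂) :
    biBracket 1 ![s₁] ![r₁] * biBracket 1 ![s₂] ![r₂] =
      biBracket 2 ![s₁, s₂] ![r₁, r₂] + biBracket 2 ![s₂, s₁] ![r₂, r₁]
        + (((r₁ + r₂).choose r₁ : ℚ)) • biBracket 1 ![s₁ + s₂] ![r₁ + r₂]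
        + (((r₁ + r₂).choose r₁ : ℚ)) •
            ∑ j ∈ Finset.Icc 1 s₁,
              ((-1 : ℚ) ^ (s₂ - 1) * (bernoulli (s₁ + s₂ - j) / ((s₁ + s₂ - j)! : ℚ)) *
                  ((s₁ + s₂ - j - 1).choose (s₁ - j) : ℚ)) •
                biBracket 1 ![j] ![r₁ + r₂]
        + (((r₁ + r₂).choose r₁ : ℚ)) •
            ∑ j ∈ Finset.Icc 1 s₂,
              ((-1 : ℚ) ^ (s₁ - 1) * (bernoulli (s₁ + s₂ - j) / ((s₁ + s₂ - j)! : ℚ)) *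
                  ((s₁ + s₂ - j - 1).choose (s₂ - j) : ℚ)) •
                biBracket 1 ![j] ![r₁ + r₂] := by
  ext n
  have hsplit : ∑ e ∈ posQuadruples n, biWeight s₁ r₁ e.1 * biWeight s₂ r₂ e.2 =
      ∑ e ∈ posQuadruples n with e.2.1 < e.1.1, biWeight s₁ r₁ e.1 * biWeight s₂ r₂ e.2 +
      ∑ e ∈ posQuadruples n with e.1.1 < e.2.1, biWeight s₁ r₁ e.1 * biWeight s₂ r₂ e.2 +
      ∑ e ∈ posQuadruples n with e.1.1 = e.2.1, biWeight s₁ r₁ e.1 * biWeight s₂ r₂ e.2 := by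
    simp only [Finset.sum_filter, ← Finset.sum_add_distrib]
    refine Finset.sum_congr rfl fun e _ => ?_
    rcases lt_trichotomy e.1.1 e.2.1 with h | h | h
    · simp [h, h.ne, h.le]
    · simp [h]
    · simp [h, h.ne', h.le]
  have hswap : ∑ e ∈ posQuadruples n with e.1.1 < e.2.1,
        biWeight s₁ r₁ e.1 * biWeight s₂ r₂ e.2 =
      ∑ e ∈ posQuadruples n with e.2.1 < e.1.1, biWeight s₂ r₂ e.1 * biWeight s₁ r₁ e.2 := by
    refine Finset.sum_nbij' Prod.swap Prod.swap ?_ ?_ (by simp) (by simp)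
      fun e _ => mul_comm _ _ <;>
    · rintro e h
      simp only [Finset.mem_filter, mem_posQuadruples, Prod.fst_swap, Prod.snd_swap] at h ⊢
      omega
  simp only [map_add, map_sum, PowerSeries.coeff_smul, smul_eq_mul]
  rw [coeff_biBracket_one_mul, coeff_biBracket_two, coeff_biBracket_two, hsplit, hswap,
    sum_posQuadruples_diag, ← Finset.mul_sum]
  simp only [coeff_biBracket_one, Finset.mul_sum (s := Finset.filter _ _)]
  rw [Finset.sum_comm, Finset.sum_comm (s := Finset.Icc 1 s₂)]
  simp only [add_assoc, ← mul_add, ← Finset.sum_add_distrib, ← Finset.mul_sum]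
  congr 2
  refine Finset.sum_congr rfl fun x hx => ?_
  simp only [Finset.mem_filter, Nat.mem_divisorsAntidiagonal] at hx
  obtain ⟨w, hw⟩ := Nat.exists_eq_succ_of_ne_zero (n := x.2) (by
    intro h
    simp [h] at hx
    omega)
  have h := powConv_eq (s₁ - 1) (s₂ - 1) w
  rw [bernoulliConv_eq_sum_Icc s₁ s₂ h₁ h₂, bernoulliConv_eq_sum_Icc s₂ s₁ h₂ h₁,
    show s₁ - 1 + (s₂ - 1) + 1 = s₁ + s₂ - 1 by omega] at h
  rw [hw, Nat.succ_eq_add_one, h]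
  simp only [biWeight, hw, Nat.succ_eq_add_one, mul_add, Finset.mul_sum, Nat.cast_add,
    Nat.cast_one, add_assoc, add_comm s₂ s₁]
  congr 2 <;> refine Finset.sum_congr rfl fun j _ => ?_ <;> ring
end

section
/- (Weight 8 relation among brackets.) In ℚ[[q]] we have [8] = (1/40)·[4] − (1/252)·[2] + 12·[4,4], where [4,4] denotes the length-two bracket and [2], [4], [8] are length-one brackets. -/
open scoped Nat

open Finset ArithmeticFunction UpperHalfPlane ModularForm EisensteinSeries MatrixGroups in
/-- The identity `E₈ = E₄²` of level one Eisenstein series, on `q`-expansions. -/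
theorem qExpansion_E_eight_eq_sq :
    qExpansion 1 (E (show 3 ≤ 8 by norm_num)) = qExpansion 1 E₄ * qExpansion 1 E₄ := by
  let F : ModularForm 𝒮ℒ (4 + 4) :=
    ModularForm.mcast (by decide) (E (show 3 ≤ 8 by norm_num)) - E₄.mul E₄
  have hF : qExpansion 1 F =
      qExpansion 1 (E (show 3 ≤ 8 by norm_num)) - qExpansion 1 E₄ * qExpansion 1 E₄ := by
    rw [← ModularForm.qExpansion_mul one_pos one_mem_strictPeriods_SL E₄ E₄]
    simp only [F, FunLike.coe_sub, coe_mcast,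
      ModularForm.qExpansion_sub one_pos one_mem_strictPeriods_SL]
  have hzero : F = 0 := sturm_bound_levelOne <| by
    refine (PowerSeries.le_order _ 1 fun i hi ↦ ?_).trans_lt' (by norm_num)
    have hi : i = 0 := by simpa using hi
    subst hi
    have h4 : PowerSeries.coeff 0 (qExpansion 1 E₄) = 1 := E_qExpansion_coeff_zero _ ⟨2, rfl⟩
    have h8 : PowerSeries.coeff 0 (qExpansion 1 (E (show 3 ≤ 8 by norm_num))) = 1 :=
      E_qExpansion_coeff_zero _ ⟨4, rfl⟩
    rw [hF, map_sub, PowerSeries.coeff_mul]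
    simp [-PowerSeries.coeff_zero_eq_constantCoeff, h4, h8]
  rw [← sub_eq_zero, ← hF, hzero]
  exact qExpansion_zero 1

open Finset ArithmeticFunction UpperHalfPlane ModularForm EisensteinSeries in
/-- The classical convolution identity `σ₇(n) = σ₃(n) + 120 ∑ σ₃(i) σ₃(n - i)`. -/
theorem sigma_seven_eq (n : ℕ) :
    sigma 7 n = sigma 3 n + 120 * ∑ p ∈ antidiagonal n, sigma 3 p.1 * sigma 3 p.2 := by
  have b4 : bernoulli 4 = -1 / 30 := by decide +kernel
  have b8 : bernoulli 8 = -1 / 30 := by decide +kernel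
  have h4 (m : ℕ) : PowerSeries.coeff m (qExpansion 1 E₄) =
      (if m = 0 then 1 else 0) + 240 * (sigma 3 m : ℂ) := by
    rw [E_qExpansion_coeff _ ⟨2, rfl⟩, b4]
    split_ifs with h
    · simp [h]
    · norm_num
  have h8 (m : ℕ) : PowerSeries.coeff m (qExpansion 1 (E (show 3 ≤ 8 by norm_num))) =
      (if m = 0 then 1 else 0) + 480 * (sigma 7 m : ℂ) := by
    rw [E_qExpansion_coeff _ ⟨4, rfl⟩, b8]
    split_ifs with h
    · simp [h]
    · norm_num
  rcases Nat.eq_zero_or_pos n with rfl | hn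
  · simp
  have key := congrArg (PowerSeries.coeff n) qExpansion_E_eight_eq_sq
  rw [PowerSeries.coeff_mul, h8] at key
  simp only [h4, add_mul, mul_add, sum_add_distrib] at key
  have e1 : ∑ p ∈ antidiagonal n, (if p.1 = 0 then (1 : ℂ) else 0) * (240 * (sigma 3 p.2 : ℂ)) =
      240 * (sigma 3 n : ℂ) := by
    rw [sum_eq_single_of_mem (0, n) (by simp)]
    · simp
    · rintro ⟨a, b⟩ hab hne
      have : a ≠ 0 := by
        rintro rfl
        simp_all
      simp [this]
  have e2 : ∑ p ∈ antidiagonal n, (240 * (sigma 3 p.1 : ℂ)) * (if p.2 = 0 then (1 : ℂ) else 0) =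
      240 * (sigma 3 n : ℂ) := by
    rw [sum_eq_single_of_mem (n, 0) (by simp)]
    · simp
    · rintro ⟨a, b⟩ hab hne
      have : b ≠ 0 := by
        rintro rfl
        simp_all
      simp [this]
  have e3 : ∑ p ∈ antidiagonal n, (if p.1 = 0 then (1 : ℂ) else 0) * (if p.2 = 0 then 1 else 0) =
      0 := by
    refine sum_eq_zero fun p hp ↦ ?_
    have := HasAntidiagonal.mem_antidiagonal.mp hp
    split_ifs <;> first | omega | simp
  have e4 : ∑ p ∈ antidiagonal n, (240 * (sigma 3 p.1 : ℂ)) * (240 * (sigma 3 p.2 : ℂ)) =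
      57600 * ∑ p ∈ antidiagonal n, (sigma 3 p.1 : ℂ) * (sigma 3 p.2 : ℂ) := by
    rw [mul_sum]
    exact sum_congr rfl fun _ _ ↦ by ring
  rw [e1, e2, e3, e4, if_neg hn.ne'] at key
  have : (sigma 7 n : ℂ) = sigma 3 n +
      120 * ∑ p ∈ antidiagonal n, (sigma 3 p.1 : ℂ) * (sigma 3 p.2 : ℂ) := by
    linear_combination key / 480
  exact_mod_cast this

open Finset ArithmeticFunction in
theorem sigma_eq_sum_divisorsAntidiagonal (k n : ℕ) :
    sigma k n = ∑ x ∈ n.divisorsAntidiagonal, x.2 ^ k := by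
  rw [sigma_apply, Nat.sum_divisorsAntidiagonal' (fun _ d ↦ d ^ k)]

open Finset ArithmeticFunction in
/-- Length one brackets are generating series of divisor power sums. -/
theorem coeff_biBracket_one_s11 (k n : ℕ) :
    PowerSeries.coeff n (biBracket 1 ![k] ![0]) = (sigma (k - 1) n : ℚ) / (k - 1)! := by
  let f : ℕ × ℕ → (Fin 1 → ℕ) × (Fin 1 → ℕ) := fun x ↦ (![x.1], ![x.2])
  have hf : Function.Injective f := by
    rintro ⟨a, b⟩ ⟨c, d⟩ h
    have h1 := congrFun (congrArg Prod.fst h) 0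
    have h2 := congrFun (congrArg Prod.snd h) 0
    simp_all [f]
  have hset : {uv : (Fin 1 → ℕ) × (Fin 1 → ℕ) | StrictAnti uv.1 ∧ (∀ j, 0 < uv.1 j) ∧
      (∀ j, 0 < uv.2 j) ∧ (∑ j, uv.1 j * uv.2 j) = n} =
      ↑(n.divisorsAntidiagonal.image f) := by
    ext ⟨u, v⟩
    simp only [Set.mem_ofPred_eq, coe_image, Set.mem_image, mem_coe, Nat.mem_divisorsAntidiagonal,
      Prod.exists, f, Prod.mk.injEq]
    constructor
    · rintro ⟨-, hu, hv, h⟩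
      have hpos := Nat.mul_pos (hu 0) (hv 0)
      refine ⟨u 0, v 0, ⟨by simpa using h, ?_⟩, ?_, ?_⟩
      · simp only [Fin.sum_univ_one] at h
        omega
      · ext i; fin_cases i; rfl
      · ext i; fin_cases i; rfl
    · rintro ⟨a, b, ⟨h, hn⟩, rfl, rfl⟩
      have : 0 < a * b := by omega
      refine ⟨Subsingleton.strictAnti _, ?_, ?_, by simpa using h⟩ <;> intro j
      · simpa using Nat.pos_of_mul_pos_right this
      · simpa using Nat.pos_of_mul_pos_left this
  rw [biBracket, PowerSeries.coeff_mk, hset, finsum_mem_coe_finset, sum_image hf.injOn,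
    sigma_eq_sum_divisorsAntidiagonal]
  simp [f, sum_div]

/-- Pairs `((u₁, v₁), (u₂, v₂))` of pairs of positive integers with `u₁ v₁ + u₂ v₂ = n`. -/
def divisorQuadruples (n : ℕ) : Finset ((ℕ × ℕ) × (ℕ × ℕ)) :=
  (((Finset.range (n + 1)) ×ˢ (Finset.range (n + 1))) ×ˢ
    ((Finset.range (n + 1)) ×ˢ (Finset.range (n + 1)))).filter fun x ↦
      (0 < x.1.1 ∧ 0 < x.1.2) ∧ (0 < x.2.1 ∧ 0 < x.2.2) ∧ x.1.1 * x.1.2 + x.2.1 * x.2.2 = n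

theorem mem_divisorQuadruples {n : ℕ} {x : (ℕ × ℕ) × (ℕ × ℕ)} :
    x ∈ divisorQuadruples n ↔
      (0 < x.1.1 ∧ 0 < x.1.2) ∧ (0 < x.2.1 ∧ 0 < x.2.2) ∧
        x.1.1 * x.1.2 + x.2.1 * x.2.2 = n := by
  simp only [divisorQuadruples, Finset.mem_filter, Finset.mem_product, Finset.mem_range,
    and_iff_right_iff_imp]
  rintro ⟨⟨h1, h2⟩, ⟨h3, h4⟩, h⟩
  have := Nat.le_mul_of_pos_right x.1.1 h2
  have := Nat.le_mul_of_pos_left x.1.2 h1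
  have := Nat.le_mul_of_pos_right x.2.1 h4
  have := Nat.le_mul_of_pos_left x.2.2 h3
  omega

open Finset ArithmeticFunction in
theorem sum_sigma_mul_sigma (k l n : ℕ) :
    ∑ p ∈ antidiagonal n, sigma k p.1 * sigma l p.2 =
      ∑ x ∈ divisorQuadruples n, x.1.2 ^ k * x.2.2 ^ l := by
  rw [← sum_fiberwise_of_maps_to (s := divisorQuadruples n) (t := antidiagonal n)
    (g := fun x ↦ (x.1.1 * x.1.2, x.2.1 * x.2.2))
    (fun x hx ↦ HasAntidiagonal.mem_antidiagonal.mpr (mem_divisorQuadruples.mp hx).2.2)]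
  refine sum_congr rfl fun p hp ↦ ?_
  rw [sigma_eq_sum_divisorsAntidiagonal, sigma_eq_sum_divisorsAntidiagonal, sum_mul_sum,
    ← sum_product']
  refine sum_congr ?_ fun _ _ ↦ rfl
  ext ⟨⟨a, b⟩, c, d⟩
  obtain ⟨i, j⟩ := p
  simp only [mem_product, Nat.mem_divisorsAntidiagonal, mem_filter, mem_divisorQuadruples,
    Prod.mk.injEq]
  rw [HasAntidiagonal.mem_antidiagonal] at hp
  constructor
  · rintro ⟨⟨rfl, h1⟩, rfl, h2⟩
    simp only [ne_eq, mul_eq_zero, not_or] at h1 h2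
    exact ⟨⟨⟨by omega, by omega⟩, ⟨by omega, by omega⟩, hp⟩, rfl, rfl⟩
  · rintro ⟨⟨⟨h1, h2⟩, ⟨h3, h4⟩, -⟩, rfl, rfl⟩
    exact ⟨⟨rfl, (Nat.mul_pos h1 h2).ne'⟩, rfl, (Nat.mul_pos h3 h4).ne'⟩

open Finset in
/-- The coefficients of `[k, l]`. -/
theorem coeff_biBracket_two_s11 (k l n : ℕ) :
    PowerSeries.coeff n (biBracket 2 ![k, l] ![0, 0]) =
      ∑ x ∈ divisorQuadruples n with x.2.1 < x.1.1,
        ((x.1.2 : ℚ) ^ (k - 1) / (k - 1)!) * ((x.2.2 : ℚ) ^ (l - 1) / (l - 1)!) := by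
  let f : (ℕ × ℕ) × (ℕ × ℕ) → (Fin 2 → ℕ) × (Fin 2 → ℕ) :=
    fun x ↦ (![x.1.1, x.2.1], ![x.1.2, x.2.2])
  have hf : Function.Injective f := by
    rintro ⟨⟨a, b⟩, c, d⟩ ⟨⟨a', b'⟩, c', d'⟩ h
    simp_all [f]
  have hset : {uv : (Fin 2 → ℕ) × (Fin 2 → ℕ) | StrictAnti uv.1 ∧ (∀ j, 0 < uv.1 j) ∧
      (∀ j, 0 < uv.2 j) ∧ (∑ j, uv.1 j * uv.2 j) = n} =
      ↑(((divisorQuadruples n).filter fun x ↦ x.2.1 < x.1.1).image f) := by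
    ext ⟨u, v⟩
    simp only [Set.mem_ofPred_eq, coe_image, Set.mem_image, mem_coe, mem_filter,
      mem_divisorQuadruples, f, Prod.mk.injEq, Fin.forall_fin_two, Fin.sum_univ_two,
      Fin.strictAnti_iff_succ_lt]
    constructor
    · rintro ⟨h, hu, hv, hn⟩
      refine ⟨((u 0, v 0), (u 1, v 1)), ⟨⟨⟨hu.1, hv.1⟩, ⟨hu.2, hv.2⟩, hn⟩, by simpa using h 0⟩,
        ?_, ?_⟩
      · ext i; fin_cases i <;> rfl
      · ext i; fin_cases i <;> rfl
    · rintro ⟨x, ⟨⟨⟨h1, h2⟩, ⟨h3, h4⟩, h⟩, hlt⟩, rfl, rfl⟩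
      exact ⟨by simpa using hlt, ⟨h1, h3⟩, ⟨h2, h4⟩, h⟩
  rw [biBracket, PowerSeries.coeff_mk, hset, finsum_mem_coe_finset, sum_image hf.injOn]
  simp [f]

open Finset in
/-- The sum of `v³ w³` over pairs with `v + w = N`. -/
theorem sum_antidiagonal_cube_mul_cube (N : ℕ) :
    ∑ p ∈ antidiagonal N, (p.1 : ℚ) ^ 3 * (p.2 : ℚ) ^ 3 =
      (N : ℚ) ^ 7 / 140 + (N : ℚ) ^ 3 / 60 - N / 42 := by
  have key (x : ℚ) (M : ℕ) : ∑ i ∈ range (M + 1), (i : ℚ) ^ 3 * (x - i) ^ 3 =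
      x ^ 3 * (M ^ 4 / 4 + M ^ 3 / 2 + M ^ 2 / 4)
        - 3 * x ^ 2 * (M ^ 5 / 5 + M ^ 4 / 2 + M ^ 3 / 3 - M / 30)
        + 3 * x * (M ^ 6 / 6 + M ^ 5 / 2 + 5 * M ^ 4 / 12 - M ^ 2 / 12)
        - (M ^ 7 / 7 + M ^ 6 / 2 + M ^ 5 / 2 - M ^ 3 / 6 + M / 42) := by
    induction M with
    | zero => simp
    | succ M ih =>
      rw [sum_range_succ, ih]
      push_cast
      ring
  rw [Nat.sum_antidiagonal_eq_sum_range_succ (fun a b ↦ (a : ℚ) ^ 3 * (b : ℚ) ^ 3)]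
  trans ∑ i ∈ range (N + 1), (i : ℚ) ^ 3 * ((N : ℚ) - i) ^ 3
  · refine sum_congr rfl fun i hi ↦ ?_
    rw [Nat.cast_sub (Nat.lt_succ_iff.mp (mem_range.mp hi))]
  · rw [key]
    ring

open Finset ArithmeticFunction in
theorem sum_divisorQuadruples_eq (n : ℕ) :
    ∑ x ∈ divisorQuadruples n with x.1.1 = x.2.1, (x.1.2 : ℚ) ^ 3 * (x.2.2 : ℚ) ^ 3 =
      (sigma 7 n : ℚ) / 140 + sigma 3 n / 60 - sigma 1 n / 42 := by
  have hmaps : ∀ x ∈ (divisorQuadruples n).filter fun x ↦ x.1.1 = x.2.1,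
      (x.1.1, x.1.2 + x.2.2) ∈ n.divisorsAntidiagonal := by
    rintro ⟨⟨a, b⟩, c, d⟩ hx
    simp only [mem_filter, mem_divisorQuadruples] at hx
    obtain ⟨⟨⟨h1, h2⟩, ⟨h3, h4⟩, rfl⟩, rfl⟩ := hx
    rw [Nat.mem_divisorsAntidiagonal]
    exact ⟨by ring, (Nat.add_pos_left (Nat.mul_pos h1 h2) _).ne'⟩
  have hfiber : ∀ y ∈ n.divisorsAntidiagonal,
      ∑ x ∈ {x ∈ divisorQuadruples n | x.1.1 = x.2.1} with (x.1.1, x.1.2 + x.2.2) = y,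
        (x.1.2 : ℚ) ^ 3 * (x.2.2 : ℚ) ^ 3 =
      ∑ p ∈ antidiagonal y.2, (p.1 : ℚ) ^ 3 * (p.2 : ℚ) ^ 3 := by
    rintro ⟨u, N⟩ hy
    obtain ⟨hy, hn⟩ := Nat.mem_divisorsAntidiagonal.mp hy
    refine sum_of_injOn (fun x ↦ (x.1.2, x.2.2)) ?_ ?_ ?_ fun _ _ ↦ rfl
    · rintro ⟨⟨a, b⟩, c, d⟩ hx ⟨⟨a', b'⟩, c', d'⟩ hx' h
      simp only [coe_filter, mem_filter, Set.mem_ofPred_eq, Prod.mk.injEq] at hx hx' h ⊢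
      omega
    · rintro ⟨⟨a, b⟩, c, d⟩ hx
      simp only [coe_filter, mem_filter, Set.mem_ofPred_eq, Prod.mk.injEq] at hx
      simpa using hx.2.2
    · rintro ⟨v, w⟩ hp hnot
      rw [HasAntidiagonal.mem_antidiagonal] at hp
      by_contra hne
      have hv : v ≠ 0 := by rintro rfl; simp at hne
      have hw : w ≠ 0 := by rintro rfl; simp at hne
      have hu : u ≠ 0 := by rintro rfl; simp at hy; omega
      refine hnot ⟨((u, v), u, w), ?_, rfl⟩
      simp only [coe_filter, mem_filter, Set.mem_ofPred_eq, mem_divisorQuadruples]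
      refine ⟨⟨⟨⟨by omega, by omega⟩, ⟨by omega, by omega⟩, ?_⟩, trivial⟩, by rw [hp]⟩
      rw [← mul_add, ← hy, ← hp]
  rw [← sum_fiberwise_of_maps_to hmaps, sum_congr rfl hfiber]
  simp only [sum_antidiagonal_cube_mul_cube, sigma_eq_sum_divisorsAntidiagonal, Nat.cast_sum,
    Nat.cast_pow, pow_one, sum_add_distrib, sum_sub_distrib, sum_div]

open Finset in
theorem sum_divisorQuadruples_split (n : ℕ) :
    ∑ x ∈ divisorQuadruples n, (x.1.2 : ℚ) ^ 3 * (x.2.2 : ℚ) ^ 3 =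
      2 * ∑ x ∈ divisorQuadruples n with x.2.1 < x.1.1, (x.1.2 : ℚ) ^ 3 * (x.2.2 : ℚ) ^ 3
        + ∑ x ∈ divisorQuadruples n with x.1.1 = x.2.1, (x.1.2 : ℚ) ^ 3 * (x.2.2 : ℚ) ^ 3 := by
  have hswap : ∑ x ∈ divisorQuadruples n with x.1.1 < x.2.1,
        (x.1.2 : ℚ) ^ 3 * (x.2.2 : ℚ) ^ 3 =
      ∑ x ∈ divisorQuadruples n with x.2.1 < x.1.1, (x.1.2 : ℚ) ^ 3 * (x.2.2 : ℚ) ^ 3 := by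
    refine sum_nbij' Prod.swap Prod.swap ?_ ?_ (fun _ _ ↦ rfl) (fun _ _ ↦ rfl)
      fun _ _ ↦ mul_comm _ _
    all_goals
      rintro ⟨⟨a, b⟩, c, d⟩ hx
      simp only [mem_filter, mem_divisorQuadruples, Prod.fst_swap, Prod.snd_swap] at hx ⊢
      omega
  rw [two_mul]
  nth_rw 1 [← hswap]
  simp only [sum_filter, ← sum_add_distrib]
  refine sum_congr rfl fun x _ ↦ ?_
  rcases lt_trichotomy x.1.1 x.2.1 with h | h | h
  · simp [h, h.not_gt, h.ne]
  · simp [h]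
  · simp [h, h.not_gt, h.ne']

/-- Weight 8 relation among brackets: `[8] = (1/40)[4] − (1/252)[2] + 12[4,4]`. -/
theorem bracket_weight_eight :
    biBracket 1 ![8] ![0] =
      (1 / 40 : ℚ) • biBracket 1 ![4] ![0] - (1 / 252 : ℚ) • biBracket 1 ![2] ![0]
        + (12 : ℚ) • biBracket 2 ![4, 4] ![0, 0] := by
  ext n
  have h := congrArg (Nat.cast (R := ℚ)) (sigma_seven_eq n)
  rw [sum_sigma_mul_sigma] at h
  push_cast at h
  rw [sum_divisorQuadruples_split, sum_divisorQuadruples_eq] at h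
  simp only [map_add, map_sub, PowerSeries.coeff_smul, smul_eq_mul, coeff_biBracket_one_s11,
    coeff_biBracket_two_s11]
  have hfac (x : (ℕ × ℕ) × (ℕ × ℕ)) :
      ((x.1.2 : ℚ) ^ (4 - 1) / (4 - 1)!) * ((x.2.2 : ℚ) ^ (4 - 1) / (4 - 1)!) =
        1 / 36 * ((x.1.2 : ℚ) ^ 3 * (x.2.2 : ℚ) ^ 3) := by
    norm_num [Nat.factorial]
    ring
  simp only [hfac, ← Finset.mul_sum]
  norm_num [Nat.factorial]
  linear_combination h / 720
end
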